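/- Let R be a commutative Noetherian local ring with residue field k. Then k admits a finite free resolution over R (equivalently, k is a perfect complex in the derived category of R) if and only if R is regular. -/

import Mathlib

open CategoryTheory RingTheory.Sequence

/-- A Noetherian local ring is regular iff its maximal ideal is generated by a
regular sequence. -/
def IsRegularLocal (R : Type u) [CommRing R] [IsLocalRing R] : Prop :=
  ∃ rs : List R, IsRegular R rs ∧ Ideal.ofList rs = IsLocalRing.maximalIdeal R

/-- `M` admits a finite free resolution: a projective resolution whose terms are finite
free modules, vanishing above some degree (i.e. `M` is a perfect complex). -/
def HasFiniteFreeResolution (R : Type u) [CommRing R] (M : ModuleCat.{u} R) : Prop :=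
  ∃ (n : ℕ) (P : ProjectiveResolution M),
    (∀ i : ℕ, Module.Free R (P.complex.X i)) ∧
    (∀ i : ℕ, Module.Finite R (P.complex.X i)) ∧
    (∀ i : ℕ, n < i → Subsingleton (P.complex.X i))

theorem aux_pd {R : Type u} [CommRing R] {M : ModuleCat.{u} R}
    (h : HasFiniteFreeResolution R M) : ∃ n, HasProjectiveDimensionLT M n := by
  obtain ⟨n, P, -, -, h⟩ := h
  refine ⟨n + 1, ?_⟩
  rw [hasProjectiveDimensionLT_iff]
  intro i hi Y e
  obtain ⟨f, hf, rfl⟩ := P.extMk_surjective e (i+1) rfl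
  have := h i (by omega)
  have : f = 0 := (ModuleCat.isZero_of_subsingleton (P.complex.X i)).eq_of_src _ _
  subst this
  simp

theorem aux_quasiIso {R : Type u} [CommRing R] (C : ChainComplex (ModuleCat.{u} R) ℕ)
    (Z : ModuleCat.{u} R) (g : C.X 0 ⟶ Z) (hw : C.d 1 0 ≫ g = 0)
    (ex0 : (ShortComplex.mk _ _ hw).Exact) (hg : Epi g) (ex1 : ∀ n, C.ExactAt (n + 1)) :
    QuasiIso ((ChainComplex.toSingle₀Equiv C Z).symm ⟨g, hw⟩) := by
  have hπ : ((ChainComplex.toSingle₀Equiv C Z).symm ⟨g, hw⟩).f 0 = g :=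
    ChainComplex.toSingle₀Equiv_symm_apply_f_zero g hw
  generalize (ChainComplex.toSingle₀Equiv C Z).symm ⟨g, hw⟩ = π at hπ ⊢
  refine ⟨fun n => ?_⟩
  cases n
  · rw [ChainComplex.quasiIsoAt₀_iff, ShortComplex.quasiIso_iff_of_zeros']
    · refine (ShortComplex.exact_and_epi_g_iff_of_iso ?_).2 ⟨ex0, hg⟩
      exact ShortComplex.isoMk (Iso.refl _) (Iso.refl _) (Iso.refl _)
        ((Category.id_comp _).trans (Category.comp_id _).symm)
        ((Category.id_comp _).trans (hπ.symm.trans (Category.comp_id _).symm))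
    · exact C.shape _ _ (by simp)
    all_goals rfl
  · rw [quasiIsoAt_iff_exactAt']
    · apply ex1
    · apply ChainComplex.exactAt_succ_single_obj

theorem aux_splice {R : Type u} [CommRing R] {S : ShortComplex (ModuleCat.{u} R)}
    (hS : S.ShortExact) [Module.Free R S.X₂] [Module.Finite R S.X₂]
    (h : HasFiniteFreeResolution R S.X₁) : HasFiniteFreeResolution R S.X₃ := by
  obtain ⟨n, P, h1, h2, h3⟩ := h
  have := hS.mono_f
  have := hS.epi_g
  obtain ⟨p, hp0, hpex, hpepi⟩ : ∃ (p : P.complex.X 0 ⟶ S.X₁) (w : P.complex.d 1 0 ≫ p = 0),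
      (ShortComplex.mk _ _ w).Exact ∧ Epi p :=
    ⟨P.π.f 0, P.complex_d_comp_π_f_zero, P.exact₀, inferInstanceAs (Epi (P.π.f 0))⟩
  have hw : P.complex.d 1 0 ≫ (p ≫ S.f) = 0 := by
    rw [← Category.assoc, hp0, Limits.zero_comp]
  let C : ChainComplex (ModuleCat.{u} R) ℕ := ChainComplex.augment P.complex (p ≫ S.f) hw
  have hp : ∀ n, Projective (C.X n) := by
    rintro (_ | n)
    · exact ModuleCat.projective_of_free (M := S.X₂) (Module.Free.chooseBasis R S.X₂)
    · exact P.projective n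
  have hw2 : C.d 1 0 ≫ S.g = 0 := by
    change (p ≫ S.f) ≫ S.g = 0
    simp
  have ex0 : (ShortComplex.mk _ _ hw2).Exact := by
    have e := hS.exact
    rw [ShortComplex.ShortExact.moduleCat_exact_iff_function_exact] at e ⊢
    intro x
    rw [ModuleCat.epi_iff_surjective] at hpepi
    refine (e x).trans ⟨?_, ?_⟩
    · rintro ⟨y, rfl⟩
      obtain ⟨z, rfl⟩ := hpepi y
      exact ⟨z, rfl⟩
    · rintro ⟨z, rfl⟩
      exact ⟨p z, rfl⟩
  have ex1 : ∀ n, C.ExactAt (n+1) := by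
    rintro (_ | n)
    · rw [HomologicalComplex.exactAt_iff' _ 2 1 0 (by simp) (by simp)]
      have hm := (ModuleCat.mono_iff_injective _).1 hS.mono_f
      rw [ShortComplex.ShortExact.moduleCat_exact_iff_function_exact] at hpex ⊢
      intro x
      refine Iff.trans ?_ (hpex x)
      change S.f (p x) = 0 ↔ p x = 0
      rw [← map_zero S.f.hom]
      exact hm.eq_iff
    · rw [HomologicalComplex.exactAt_iff' _ (n+3) (n+2) (n+1) (by simp) (by simp)]
      exact P.exact_succ n
  refine ⟨n + 1, { complex := C, projective := hp, π := (ChainComplex.toSingle₀Equiv _ _).symm ⟨S.g, hw2⟩, quasiIso := aux_quasiIso C S.X₃ S.g hw2 ex0 ‹_› ex1 }, ?_, ?_, ?_⟩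
  · rintro (_ | i)
    · assumption
    · exact h1 i
  · rintro (_ | i)
    · assumption
    · exact h2 i
  · rintro (_ | i) hi
    · omega
    · exact h3 i (by omega)

theorem aux_res {R : Type u} [CommRing R] [IsNoetherianRing R] [IsLocalRing R] (n : ℕ)
    (M : ModuleCat.{u} R) [Module.Finite R M] (h : HasProjectiveDimensionLT M (n + 1)) :
    HasFiniteFreeResolution R M := by
  induction n generalizing M with
  | zero =>
    rw [zero_add, ← projective_iff_hasProjectiveDimensionLT_one] at h
    have : Module.Projective R M := (IsProjective.iff_projective _).2 h
    have : Module.Free R M := Module.free_of_flat_of_isLocalRing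
    refine ⟨0, ProjectiveResolution.self M, ?_, ?_, ?_⟩
    · rintro (_ | i)
      · exact ‹Module.Free R M›
      · have : Subsingleton ((ProjectiveResolution.self M).complex.X (i+1)) :=
          ModuleCat.subsingleton_of_isZero (HomologicalComplex.isZero_single_obj_X _ _ _ _ (by simp))
        infer_instance
    · rintro (_ | i)
      · exact ‹Module.Finite R M›
      · have : Subsingleton ((ProjectiveResolution.self M).complex.X (i+1)) :=
          ModuleCat.subsingleton_of_isZero (HomologicalComplex.isZero_single_obj_X _ _ _ _ (by simp))
        infer_instance
    · rintro (_ | i) hi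
      · omega
      · exact ModuleCat.subsingleton_of_isZero (HomologicalComplex.isZero_single_obj_X _ _ _ _ (by simp))
  | succ n ih =>
    obtain ⟨F, _, _, _, _, f, hf⟩ := Module.exists_finite_presentation R M
    have hS := LinearMap.shortExact_shortComplexKer hf
    have : Projective (ModuleCat.of R F) := (IsProjective.iff_projective (R := R) F).1 inferInstance
    have h1 := (hS.hasProjectiveDimensionLT_X₃_iff n this).1 h
    exact aux_splice hS (ih _ h1)


theorem aux_mpr {R : Type u} [CommRing R] [IsNoetherianRing R] [IsLocalRing R]
    (h : IsRegularLocal R) :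
    HasFiniteFreeResolution R (ModuleCat.of R (IsLocalRing.ResidueField R)) := by
  obtain ⟨rs, h1, h2⟩ := h
  have h3 := ModuleCat.projectiveDimension_quotient_eq_length rs h1
  have h4 := h3.le
  rw [projectiveDimension_le_iff] at h4
  have e : (Shrink.{u} (R ⧸ Ideal.ofList rs)) ≃ₗ[R] IsLocalRing.ResidueField R :=
    (Shrink.linearEquiv R _).trans (Submodule.quotEquivOfEq _ _ h2)
  exact aux_res rs.length _ (hasProjectiveDimensionLT_of_iso e.toModuleIso _)

theorem aux_mincover {R : Type u} [CommRing R] [IsNoetherianRing R] [IsLocalRing R]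
    (M : Type u) [AddCommGroup M] [Module R M] [Module.Finite R M] :
    ∃ (n : ℕ) (f : (Fin n →₀ R) →ₗ[R] M), Function.Surjective f ∧
      ∀ x, f x = 0 → ∀ i, x i ∈ IsLocalRing.maximalIdeal R := by
  let k := IsLocalRing.ResidueField R
  let b := Module.finBasis k (TensorProduct R k M)
  have hs := TensorProduct.mk_surjective R M k IsLocalRing.residue_surjective
  choose m hm using fun i => hs (b i)
  refine ⟨_, Finsupp.linearCombination R m, ?_, ?_⟩
  · rw [← LinearMap.range_eq_top, Finsupp.range_linearCombination]
    exact IsLocalRing.span_eq_top_of_tmul_eq_basis m b hm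
  · intro x hx i
    have h1 : ∑ i, IsLocalRing.residue R (x i) • b i = 0 := by
      rw [Finsupp.linearCombination_apply, Finsupp.sum_fintype _ _ (by simp)] at hx
      have h2 := congrArg (TensorProduct.mk R k M 1) hx
      rw [map_sum, map_zero] at h2
      rw [← h2]
      refine Finset.sum_congr rfl fun i _ => ?_
      rw [map_smul, hm]
      exact algebraMap_smul k (x i) (b i)
    have h3 := Fintype.linearIndependent_iff.1 b.linearIndependent _ h1 i
    exact (IsLocalRing.residue_eq_zero_iff _).1 h3

theorem aux_socle {R : Type u} [CommRing R] [IsNoetherianRing R] [IsLocalRing R] (s : R)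
    (hs : s ≠ 0) (hs' : ∀ a ∈ IsLocalRing.maximalIdeal R, s * a = 0) (n : ℕ)
    (M : ModuleCat.{u} R) [Module.Finite R M] (h : HasProjectiveDimensionLT M (n + 1)) :
    Module.Free R M := by
  induction n generalizing M with
  | zero =>
    rw [zero_add, ← projective_iff_hasProjectiveDimensionLT_one] at h
    have : Module.Projective R M := (IsProjective.iff_projective _).2 h
    exact Module.free_of_flat_of_isLocalRing
  | succ n ih =>
    obtain ⟨r, f, hf, hk⟩ := aux_mincover (R := R) M
    have hS := LinearMap.shortExact_shortComplexKer hf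
    have : Projective (ModuleCat.of R (Fin r →₀ R)) :=
      (IsProjective.iff_projective (R := R) (Fin r →₀ R)).1 inferInstance
    have h1 := (hS.hasProjectiveDimensionLT_X₃_iff n this).1 h
    have : Module.Free R (LinearMap.ker f) := ih _ h1
    have hsub : Subsingleton (LinearMap.ker f) := by
      by_contra hc
      rw [not_subsingleton_iff_nontrivial] at hc
      have h2 : s ∈ Module.annihilator R (LinearMap.ker f) := by
        rw [Module.mem_annihilator]
        rintro ⟨x, hx⟩
        ext i
        exact hs' _ (hk x hx i)
      rw [(Module.annihilator_eq_bot (R := R) (M := LinearMap.ker f)).2 inferInstance] at h2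
      exact hs h2
    have hinj : Function.Injective f := by
      rw [← LinearMap.ker_eq_bot]
      exact Submodule.subsingleton_iff_eq_bot.1 hsub
    exact Module.Free.of_equiv (LinearEquiv.ofBijective f ⟨hinj, hf⟩)

theorem aux_socle' {R : Type u} [CommRing R] [IsNoetherianRing R] [IsLocalRing R]
    (h : ∃ n, HasProjectiveDimensionLT (ModuleCat.of R (IsLocalRing.ResidueField R)) n)
    (hm : IsLocalRing.maximalIdeal R ∈ associatedPrimes R R) :
    IsLocalRing.maximalIdeal R = ⊥ := by
  obtain ⟨n, h⟩ := h
  have h' : HasProjectiveDimensionLT (ModuleCat.of R (IsLocalRing.ResidueField R)) (n+1) :=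
    hasProjectiveDimensionLT_of_ge _ n (n+1) (by omega)
  have hm := (isAssociatedPrime_iff_exists_injective_linearMap _ _).1 hm
  obtain ⟨-, f, hf⟩ := hm
  have hf' : f 1 ≠ 0 := by
    rw [← map_zero f]
    exact hf.ne one_ne_zero
  have : Module.Finite R (IsLocalRing.ResidueField R) := inferInstance
  have : Module.Free R (IsLocalRing.ResidueField R) := by
    refine aux_socle (f 1) hf' ?_ n _ h'
    intro a ha
    rw [mul_comm, ← smul_eq_mul, ← map_smul, ← map_zero f]
    congr 1
    have : (Ideal.Quotient.mk (IsLocalRing.maximalIdeal R) a) = 0 := Ideal.Quotient.eq_zero_iff_mem.2 ha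
    rw [Algebra.smul_def, mul_one]; exact this
  have h2 := (Module.annihilator_eq_bot (R := R) (M := IsLocalRing.ResidueField R)).2 inferInstance
  have h3 : Module.annihilator R (IsLocalRing.ResidueField R) = IsLocalRing.maximalIdeal R :=
    Ideal.annihilator_quotient
  rw [← h3, h2]

theorem aux_avoid {R : Type u} [CommRing R] [IsNoetherianRing R] [IsLocalRing R]
    (hm : IsLocalRing.maximalIdeal R ∉ associatedPrimes R R)
    (hb : IsLocalRing.maximalIdeal R ≠ ⊥) :
    ∃ x ∈ IsLocalRing.maximalIdeal R, x ∉ IsLocalRing.maximalIdeal R ^ 2 ∧ IsSMulRegular R x := by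
  by_contra! hc
  have hfin := (associatedPrimes.finite R R)
  have hsub : (IsLocalRing.maximalIdeal R : Set R) ⊆
      ⋃ i ∈ insert (IsLocalRing.maximalIdeal R ^ 2) (associatedPrimes R R), ((i : Ideal R) : Set R) := by
    intro x hx
    rw [Set.biUnion_insert]
    by_cases h : x ∈ IsLocalRing.maximalIdeal R ^ 2
    · exact Or.inl h
    · right
      rw [biUnion_associatedPrimes_eq_compl_regular]
      exact hc x hx h
  rw [Ideal.subset_union_prime_finite (hfin.insert _) (IsLocalRing.maximalIdeal R ^ 2) (IsLocalRing.maximalIdeal R ^ 2)] at hsub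
  · obtain ⟨i, hi, hle⟩ := hsub
    rcases hi with rfl | hi
    · apply hb
      apply Submodule.eq_bot_of_le_smul_of_le_jacobson_bot (IsLocalRing.maximalIdeal R) _ (IsNoetherian.noetherian _)
      · rwa [smul_eq_mul, ← sq]
      · rw [IsLocalRing.jacobson_eq_maximalIdeal _ bot_ne_top]
    · have : i.IsPrime := hi.isPrime
      exact hm (le_antisymm (IsLocalRing.le_maximalIdeal this.ne_top) hle ▸ hi)
  · intro i hi h1 _
    rcases hi with rfl | hi
    · exact absurd rfl h1
    · exact hi.isPrime

theorem aux_ses {R : Type u} [CommRing R] {A B C : Type u} [AddCommGroup A] [AddCommGroup B]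
    [AddCommGroup C] [Module R A] [Module R B] [Module R C] [Module.Projective R B]
    (g1 : A →ₗ[R] B) (g2 : B →ₗ[R] C) (e3 : Function.Injective g1) (e1 : Function.Exact g1 g2)
    (e2 : Function.Surjective g2) (n : ℕ) (h : HasProjectiveDimensionLT (ModuleCat.of R A) (n + 1)) :
    HasProjectiveDimensionLT (ModuleCat.of R C) (n + 2) := by
  let S : ShortComplex (ModuleCat.{u} R) :=
    ShortComplex.mk (ModuleCat.ofHom g1) (ModuleCat.ofHom g2) (by
      ext y; exact e1.apply_apply_eq_zero y)
  have hS' : S.ShortExact := 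
    { exact := (ShortComplex.ShortExact.moduleCat_exact_iff_function_exact _).2 e1
      mono_f := (ModuleCat.mono_iff_injective _).2 e3
      epi_g := (ModuleCat.epi_iff_surjective _).2 e2 }
  have : Projective S.X₂ := (IsProjective.iff_projective B).1 inferInstance
  exact (hS'.hasProjectiveDimensionLT_X₃_iff n this).2 h

theorem aux_change {R : Type u} [CommRing R] [IsNoetherianRing R] [IsLocalRing R] (x : R)
    (hx : IsSMulRegular R x) (n : ℕ)
    (M : ModuleCat.{u} R) [Module.Finite R M] (hM : IsSMulRegular M x)
    (h : HasProjectiveDimensionLT M (n + 1)) :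
    HasProjectiveDimensionLT (ModuleCat.of (R ⧸ Ideal.span {x}) (QuotSMulTop x M)) (n + 1) := by
  induction n generalizing M with
  | zero =>
    rw [zero_add, ← projective_iff_hasProjectiveDimensionLT_one] at h ⊢
    have : Module.Projective R M := (IsProjective.iff_projective _).2 h
    have : Module.Free R M := Module.free_of_flat_of_isLocalRing
    exact (IsProjective.iff_projective _).1 inferInstance
  | succ n ih =>
    obtain ⟨F, _, _, _, _, f, hf⟩ := Module.exists_finite_presentation R M
    have hS := LinearMap.shortExact_shortComplexKer hf
    have : Projective (ModuleCat.of R F) := (IsProjective.iff_projective (R := R) F).1 inferInstance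
    have h1 := (hS.hasProjectiveDimensionLT_X₃_iff n this).1 h
    have hF : IsSMulRegular F x := by
      have e := (Module.Free.chooseBasis R F).repr
      rw [e.isSMulRegular_congr]
      intro a b hab
      ext i
      exact hx (DFunLike.congr_fun hab i)
    have hK : IsSMulRegular (LinearMap.ker f) x := hF.submodule _ _
    have h2 := ih (ModuleCat.of R (LinearMap.ker f)) hK h1
    have hs : Function.Surjective (Ideal.Quotient.mk (Ideal.span {x})) := Ideal.Quotient.mk_surjective
    let g1 : QuotSMulTop x (LinearMap.ker f) →ₗ[R ⧸ Ideal.span {x}] QuotSMulTop x F :=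
      (QuotSMulTop.map x (LinearMap.ker f).subtype).extendScalarsOfSurjective hs
    let g2 : QuotSMulTop x F →ₗ[R ⧸ Ideal.span {x}] QuotSMulTop x M :=
      (QuotSMulTop.map x f).extendScalarsOfSurjective hs
    have hex : Function.Exact (LinearMap.ker f).subtype f := f.exact_subtype_ker_map
    have e1 : Function.Exact g1 g2 := QuotSMulTop.map_exact x hex hf
    have e2 : Function.Surjective g2 := QuotSMulTop.map_surjective x hf
    have e3 : Function.Injective g1 := by
      rw [injective_iff_map_eq_zero]
      intro a ha
      obtain ⟨y, rfl⟩ := Submodule.mkQ_surjective _ a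
      have h3 : (Submodule.Quotient.mk (y : F) : QuotSMulTop x F) = 0 := ha
      rw [Submodule.Quotient.mk_eq_zero, Submodule.mem_smul_pointwise_iff_exists] at h3
      obtain ⟨z, -, hz⟩ := h3
      have h4 : x • f z = 0 := by
        rw [← map_smul, hz]; exact y.2
      have h5 : f z = 0 := hM.right_eq_zero_of_smul h4
      refine (Submodule.Quotient.mk_eq_zero _).2 ?_
      rw [Submodule.mem_smul_pointwise_iff_exists]
      exact ⟨⟨z, h5⟩, trivial, Subtype.ext hz⟩
    exact aux_ses g1 g2 e3 e1 e2 n h2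

open Pointwise in
theorem aux_retr0 {R : Type u} [CommRing R] [IsLocalRing R] (x : R)
    (hx : x ∈ IsLocalRing.maximalIdeal R) (hx2 : x ∉ IsLocalRing.maximalIdeal R ^ 2) :
    ∃ (i : (R ⧸ IsLocalRing.maximalIdeal R) →ₗ[R] QuotSMulTop x (IsLocalRing.maximalIdeal R))
      (r : QuotSMulTop x (IsLocalRing.maximalIdeal R) →ₗ[R] (R ⧸ IsLocalRing.maximalIdeal R)),
      r ∘ₗ i = LinearMap.id := by
  let m := IsLocalRing.maximalIdeal R
  let q : QuotSMulTop x m := Submodule.Quotient.mk ⟨x, hx⟩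
  have hi : m ≤ LinearMap.ker (LinearMap.toSpanSingleton R _ q) := by
    intro a ha
    rw [LinearMap.mem_ker, LinearMap.toSpanSingleton_apply]
    refine (Submodule.Quotient.mk_eq_zero _).2 ?_
    rw [Submodule.mem_smul_pointwise_iff_exists]
    exact ⟨⟨a, ha⟩, trivial, Subtype.ext (mul_comm _ _)⟩
  have hc : m.toCotangent ⟨x, hx⟩ ≠ 0 := by
    rwa [Ne, Ideal.toCotangent_eq_zero]
  obtain ⟨φ, hφ⟩ : ∃ φ : m.Cotangent →ₗ[R] (R ⧸ m), φ (m.toCotangent ⟨x, hx⟩) = 1 := by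
    have := mt (Module.forall_dual_apply_eq_zero_iff (IsLocalRing.ResidueField R)
      (V := IsLocalRing.CotangentSpace R) (m.toCotangent ⟨x, hx⟩)).1 hc
    push Not at this
    obtain ⟨φ, hφ⟩ := this
    refine ⟨((φ (m.toCotangent ⟨x, hx⟩))⁻¹ • φ).restrictScalars R, ?_⟩
    exact inv_mul_cancel₀ hφ
  have hr : x • (⊤ : Submodule R m) ≤ LinearMap.ker (φ ∘ₗ m.toCotangent) := by
    intro a ha
    rw [Submodule.mem_smul_pointwise_iff_exists] at ha
    obtain ⟨b, -, rfl⟩ := ha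
    rw [LinearMap.mem_ker, LinearMap.comp_apply, map_smul, Ideal.Cotangent.smul_eq_zero_of_mem hx,
      map_zero]
  refine ⟨Submodule.liftQ _ _ hi, Submodule.liftQ _ _ hr, ?_⟩
  refine Submodule.linearMap_qext _ (LinearMap.ext_ring ?_)
  change φ (m.toCotangent ((1 : R) • ⟨x, hx⟩)) = 1
  rw [one_smul, hφ]

theorem aux_comap {R : Type u} [CommRing R] [IsLocalRing R] (x : R)
    [IsLocalRing (R ⧸ Ideal.span {x})] :
    (IsLocalRing.maximalIdeal (R ⧸ Ideal.span {x})).comap (Ideal.Quotient.mk _) =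
      IsLocalRing.maximalIdeal R := by
  have := Ideal.comap_isMaximal_of_surjective (Ideal.Quotient.mk (Ideal.span {x}))
    Ideal.Quotient.mk_surjective (K := IsLocalRing.maximalIdeal _)
  exact IsLocalRing.eq_maximalIdeal this

theorem aux_equiv {R : Type u} [CommRing R] [IsLocalRing R] (x : R)
    [IsLocalRing (R ⧸ Ideal.span {x})] :
    Nonempty ((R ⧸ IsLocalRing.maximalIdeal R) ≃ₗ[R]
      IsLocalRing.ResidueField (R ⧸ Ideal.span {x})) := by
  let f : R →ₗ[R] IsLocalRing.ResidueField (R ⧸ Ideal.span {x}) := Algebra.linearMap _ _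
  have hf : Function.Surjective f :=
    (IsLocalRing.residue_surjective (R := R ⧸ Ideal.span {x})).comp Ideal.Quotient.mk_surjective
  refine ⟨(Submodule.quotEquivOfEq _ _ ?_).trans (f.quotKerEquivOfSurjective hf)⟩
  rw [← aux_comap x]
  ext a
  exact (IsLocalRing.residue_eq_zero_iff (Ideal.Quotient.mk (Ideal.span {x}) a)).symm

theorem aux_retr {R : Type u} [CommRing R] [IsLocalRing R] (x : R)
    (hx : x ∈ IsLocalRing.maximalIdeal R) (hx2 : x ∉ IsLocalRing.maximalIdeal R ^ 2) 
    [IsLocalRing (R ⧸ Ideal.span {x})] :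
    Nonempty (Retract (ModuleCat.of (R ⧸ Ideal.span {x}) (IsLocalRing.ResidueField (R ⧸ Ideal.span {x})))
      (ModuleCat.of (R ⧸ Ideal.span {x}) (QuotSMulTop x (IsLocalRing.maximalIdeal R)))) := by
  obtain ⟨i, r, hir⟩ := aux_retr0 x hx hx2
  obtain ⟨e⟩ := aux_equiv x
  have hs : Function.Surjective (Ideal.Quotient.mk (Ideal.span {x})) := Ideal.Quotient.mk_surjective
  let i' : IsLocalRing.ResidueField (R ⧸ Ideal.span {x}) →ₗ[R ⧸ Ideal.span {x}] 
    QuotSMulTop x (IsLocalRing.maximalIdeal R) := (i ∘ₗ e.symm.toLinearMap).extendScalarsOfSurjective hs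
  let r' : QuotSMulTop x (IsLocalRing.maximalIdeal R) →ₗ[R ⧸ Ideal.span {x}] 
    IsLocalRing.ResidueField (R ⧸ Ideal.span {x}) := (e.toLinearMap ∘ₗ r).extendScalarsOfSurjective hs
  have h : ∀ a, r' (i' a) = a := by
    intro a
    change e (r (i (e.symm a))) = a
    rw [← LinearMap.comp_apply, hir, LinearMap.id_apply, e.apply_symm_apply]
  exact ⟨⟨ModuleCat.ofHom i', ModuleCat.ofHom r', by ext a; exact h a⟩⟩


theorem aux_lift {R : Type u} [CommRing R] [IsLocalRing R] [IsNoetherianRing R] (x : R)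
    (hx : x ∈ IsLocalRing.maximalIdeal R) (hreg : IsSMulRegular R x)
    [IsLocalRing (R ⧸ Ideal.span {x})] (h : IsRegularLocal (R ⧸ Ideal.span {x})) :
    IsRegularLocal R := by
  obtain ⟨rs', h1, h2⟩ := h
  obtain ⟨rs, rfl⟩ := (List.map_surjective_iff.2
    (Ideal.Quotient.mk_surjective (I := Ideal.span {x}))) rs'
  have h3 : Ideal.ofList (x :: rs) = IsLocalRing.maximalIdeal R := by
    rw [Ideal.ofList_cons, ← aux_comap x, ← h2, ← Ideal.map_ofList,
      Ideal.comap_map_of_surjective' _ Ideal.Quotient.mk_surjective, Ideal.mk_ker, sup_comm]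
  refine ⟨x :: rs, ?_, h3⟩
  have hw : IsWeaklyRegular R (x :: rs) := by
    rw [isWeaklyRegular_cons_iff]
    refine ⟨hreg, ?_⟩
    have h4 : IsWeaklyRegular (R ⧸ Ideal.span {x}) rs :=
      (isWeaklyRegular_map_algebraMap_iff (R ⧸ Ideal.span {x}) (R ⧸ Ideal.span {x}) rs).1 h1.1
    refine (LinearEquiv.isWeaklyRegular_congr (Submodule.quotEquivOfEq _ _ ?_) rs).2 h4
    rw [← Submodule.ideal_span_singleton_smul, smul_eq_mul, Ideal.mul_top]
  refine IsRegular.of_isWeaklyRegular_of_mem_maximalIdeal R ?_ hw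
  intro r hr
  rw [← h3]
  exact Ideal.subset_span hr

theorem aux_mp (d : ℕ) (R : Type u) [CommRing R] [IsNoetherianRing R] [IsLocalRing R]
    (hd : ringKrullDim R < d)
    (h : ∃ n, HasProjectiveDimensionLT (ModuleCat.of R (IsLocalRing.ResidueField R)) n) :
    IsRegularLocal R := by
  induction d generalizing R with
  | zero =>
    exact absurd hd (not_lt.2 (by exact_mod_cast ringKrullDim_nonneg_of_nontrivial))
  | succ d ih =>
    by_cases hb : IsLocalRing.maximalIdeal R = ⊥
    · exact ⟨[], IsRegular.nil R R, by rw [hb, Ideal.ofList_nil]⟩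
    obtain ⟨x, hx, hx2, hreg⟩ := aux_avoid (mt (aux_socle' h) hb) hb
    have : Nontrivial (R ⧸ Ideal.span {x}) := by
      rw [Ideal.Quotient.nontrivial_iff]
      intro ht
      exact hx (Ideal.span_singleton_eq_top.1 ht)
    have : IsLocalRing (R ⧸ Ideal.span {x}) :=
      IsLocalRing.of_surjective' _ (Ideal.Quotient.mk_surjective (I := Ideal.span {x}))
    refine aux_lift x hx hreg (ih _ ?_ ?_)
    · have h1 : x ∈ nonZeroDivisors R := by
        rw [mem_nonZeroDivisors_iff_right]
        intro y hy
        exact hreg.right_eq_zero_of_smul (by rwa [smul_eq_mul, mul_comm])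
      have h2 := ringKrullDim_quotient_succ_le_of_nonZeroDivisor h1
      have h3 := h2.trans_lt hd
      generalize ringKrullDim (R ⧸ Ideal.span {x}) = t at h3 ⊢
      induction t with
      | bot => exact WithBot.bot_lt_coe _
      | coe t =>
        induction t with
        | top => exact absurd h3 (not_lt.2 le_top)
        | coe t =>
          have h4 : t + 1 < d + 1 := by exact_mod_cast h3
          have h5 : t < d := by omega
          exact_mod_cast h5
    · obtain ⟨n, h⟩ := h
      have hS := LinearMap.shortExact_shortComplexKer
        (IsLocalRing.maximalIdeal R).mkQ_surjective
      have hP : Projective (ModuleCat.of R R) := (IsProjective.iff_projective (R := R) R).1 inferInstance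
      have h' : HasProjectiveDimensionLT (ModuleCat.of R (IsLocalRing.ResidueField R)) (n+2) :=
        hasProjectiveDimensionLT_of_ge _ n (n+2) (by omega)
      have h1 := (hS.hasProjectiveDimensionLT_X₃_iff n hP).1 h'
      have e : LinearMap.ker (IsLocalRing.maximalIdeal R).mkQ ≃ₗ[R] IsLocalRing.maximalIdeal R :=
        LinearEquiv.ofEq _ _ (Submodule.ker_mkQ _)
      have h2 : HasProjectiveDimensionLT (ModuleCat.of R (IsLocalRing.maximalIdeal R)) (n+1) :=
        @hasProjectiveDimensionLT_of_iso _ _ _ _ _ e.toModuleIso _ h1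
      have h3 := aux_change x hreg n (ModuleCat.of R (IsLocalRing.maximalIdeal R))
        (hreg.submodule _ _) h2
      obtain ⟨ρ⟩ := aux_retr x hx hx2
      exact ⟨n + 1, @Retract.hasProjectiveDimensionLT _ _ _ _ _ ρ _ h3⟩

/-- **Auslander–Buchsbaum–Serre.** Let `R` be a commutative Noetherian
local ring with residue field `k`.  Then `k` admits a finite free resolution over `R`
(equivalently, `k` is perfect in the derived category of `R`) if and only if `R` is
regular. -/
theorem stmt6 {R : Type u} [CommRing R] [IsNoetherianRing R] [IsLocalRing R] :
    HasFiniteFreeResolution R (ModuleCat.of R (IsLocalRing.ResidueField R)) ↔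
      IsRegularLocal R := by
  refine ⟨fun h => ?_, aux_mpr⟩
  obtain ⟨d, hd⟩ : ∃ d : ℕ, ringKrullDim R < d := by
    have h1 : ringKrullDim R ≠ ⊤ := ringKrullDim_ne_top
    generalize ringKrullDim R = t at h1 ⊢
    induction t with
    | bot => exact ⟨0, WithBot.bot_lt_coe _⟩
    | coe t =>
      induction t with
      | top => exact absurd rfl h1
      | coe t =>
        refine ⟨t + 1, ?_⟩
        have h5 : t < t + 1 := by omega
        exact_mod_cast h5
  exact aux_mp d R hd (aux_pd h)
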